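/- Let n ≥ 3 and let C be a set of vertices of the cycle graph on n vertices such that the subgraph induced on C is preconnected. Then the subgraph induced on the complement of C is also preconnected. In particular, the cycle graph on n vertices has no cut that is connected. -/

import Mathlib

namespace SimpleGraph

theorem cycleGraph_adj_val_cases {n : ℕ} {u v : Fin n} (h : (cycleGraph n).Adj u v) :
    u.val + 1 = v.val ∨ v.val + 1 = u.val ∨
      (u.val = 0 ∧ v.val + 1 = n) ∨ (v.val = 0 ∧ u.val + 1 = n) := by
  have hu := u.isLt
  have hv := v.isLt
  rcases cycleGraph_adj'.1 h with h | h <;> rw [Fin.val_sub] at h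
  · by_cases hle : v.val ≤ u.val
    · rw [show n - v.val + u.val = n + (u.val - v.val) by omega, Nat.add_mod_left,
        Nat.mod_eq_of_lt (by omega)] at h
      omega
    · rw [Nat.mod_eq_of_lt (by omega)] at h
      omega
  · by_cases hle : u.val ≤ v.val
    · rw [show n - u.val + v.val = n + (v.val - u.val) by omega, Nat.add_mod_left,
        Nat.mod_eq_of_lt (by omega)] at h
      omega
    · rw [Nat.mod_eq_of_lt (by omega)] at h
      omega

theorem cycleGraph_adj_zero_last {n : ℕ} (hn : 2 ≤ n) {u v : Fin n} (hu : u.val = 0)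
    (hv : v.val + 1 = n) : (cycleGraph n).Adj u v := by
  refine cycleGraph_adj'.2 (Or.inl ?_)
  rw [Fin.val_sub, Nat.mod_eq_of_lt (by omega)]
  omega

/-- Two vertices are joined inside `S` when `S` contains the interval between them. -/
theorem cycleGraph_induce_reachable_of_Icc_subset {n : ℕ} {S : Set (Fin n)} {a b : Fin n}
    (ha : a ∈ S) (hb : b ∈ S) (hab : a ≤ b) (h : Set.Icc a b ⊆ S) :
    ((cycleGraph n).induce S).Reachable ⟨a, ha⟩ ⟨b, hb⟩ := by
  obtain ⟨k, hk⟩ := Nat.exists_eq_add_of_le (Fin.le_def.1 hab)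
  induction k generalizing b with
  | zero =>
    obtain rfl : b = a := Fin.ext hk
    rfl
  | succ k ih =>
    let c : Fin n := ⟨a.val + k, by omega⟩
    have hac : a ≤ c := Fin.le_def.2 (Nat.le_add_right _ _)
    have hcb : c.val + 1 = b.val := hk.symm
    have hcle : c ≤ b := Fin.le_def.2 (by omega)
    have hadj : (cycleGraph n).Adj c b :=
      pathGraph_le_cycleGraph (pathGraph_adj.2 (Or.inl hcb))
    have hcS : c ∈ S := h ⟨hac, hcle⟩
    have step : ((cycleGraph n).induce S).Adj ⟨c, hcS⟩ ⟨b, hb⟩ := hadj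
    exact (ih hcS hac ((Set.Icc_subset_Icc_right hcle).trans h) rfl).trans step.reachable

/-- Two vertices are joined inside `S` when `S` contains everything not strictly between them. -/
theorem cycleGraph_induce_reachable_of_compl_Ioo_subset {n : ℕ} (hn : 2 ≤ n) {S : Set (Fin n)}
    {a b : Fin n} (ha : a ∈ S) (hb : b ∈ S) (h : (Set.Ioo a b)ᶜ ⊆ S) :
    ((cycleGraph n).induce S).Reachable ⟨a, ha⟩ ⟨b, hb⟩ := by
  let first : Fin n := ⟨0, by omega⟩
  let last : Fin n := ⟨n - 1, by omega⟩
  have hfa : first ≤ a := Fin.le_def.2 (Nat.zero_le _)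
  have hbl : b ≤ last := Fin.le_def.2 (Nat.le_sub_one_of_lt b.isLt)
  have hfS : first ∈ S := h fun hz => hz.1.not_ge hfa
  have hlS : last ∈ S := h fun hz => hz.2.not_ge hbl
  have wrap : ((cycleGraph n).induce S).Adj ⟨first, hfS⟩ ⟨last, hlS⟩ :=
    cycleGraph_adj_zero_last hn (u := first) (v := last) rfl (Nat.sub_add_cancel (by omega))
  exact (cycleGraph_induce_reachable_of_Icc_subset hfS ha hfa
      fun z hz => h fun hz' => hz'.1.not_ge hz.2).symm.trans <|
    wrap.reachable.trans
      (cycleGraph_induce_reachable_of_Icc_subset hb hlS hbl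
        fun z hz => h fun hz' => hz'.2.not_ge hz.1).symm

/-- A walk avoiding `a` and `b` cannot leave the open interval between them. -/
theorem cycleGraph_induce_mem_Ioo_of_reachable {n : ℕ} {C : Set (Fin n)} {a b : Fin n}
    (ha : a ∉ C) (hb : b ∉ C) {x y : C} (h : ((cycleGraph n).induce C).Reachable x y)
    (hx : x.val ∈ Set.Ioo a b) : y.val ∈ Set.Ioo a b := by
  obtain ⟨p⟩ := h
  induction p with
  | nil => exact hx
  | @cons u v w huv p ih =>
    refine ih ?_
    have hva : v.val.val ≠ a.val := fun e => ha (Fin.ext e ▸ v.property)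
    have hvb : v.val.val ≠ b.val := fun e => hb (Fin.ext e ▸ v.property)
    have hcases := cycleGraph_adj_val_cases (induce_adj.1 huv)
    have hblt := b.isLt
    simp only [Set.mem_Ioo, Fin.lt_def] at hx ⊢
    omega

theorem cycleGraph_induce_compl_reachable_of_le {n : ℕ} (hn : 2 ≤ n) {C : Set (Fin n)}
    (hconn : ((cycleGraph n).induce C).Preconnected) {a b : Fin n}
    (ha : a ∈ Cᶜ) (hb : b ∈ Cᶜ) (hab : a ≤ b) :
    ((cycleGraph n).induce Cᶜ).Reachable ⟨a, ha⟩ ⟨b, hb⟩ := by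
  by_cases hx : ∃ x ∈ C, x ∈ Set.Ioo a b
  · obtain ⟨x, hxC, hx⟩ := hx
    exact cycleGraph_induce_reachable_of_compl_Ioo_subset hn ha hb fun y hy hyC =>
      hy (cycleGraph_induce_mem_Ioo_of_reachable ha hb (hconn ⟨x, hxC⟩ ⟨y, hyC⟩) hx)
  · refine cycleGraph_induce_reachable_of_Icc_subset ha hb hab fun z hz hzC => hx ⟨z, hzC, ?_⟩
    exact ⟨hz.1.lt_of_ne fun e => ha (e ▸ hzC), hz.2.lt_of_ne fun e => hb (e ▸ hzC)⟩

end SimpleGraph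

/-- If the subgraph of the cycle graph on `n ≥ 3` vertices induced on a set `C`
is preconnected, then so is the subgraph induced on the complement of `C`:
the cycle graph has no connected cut. -/
theorem stmt_7 (n : ℕ) (hn : 3 ≤ n) (C : Set (Fin n))
    (hconn : ((SimpleGraph.cycleGraph n).induce C).Preconnected) :
    ((SimpleGraph.cycleGraph n).induce Cᶜ).Preconnected := by
  rintro ⟨a, ha⟩ ⟨b, hb⟩
  have hn2 : 2 ≤ n := by omega
  rcases le_total a b with hab | hba
  · exact SimpleGraph.cycleGraph_induce_compl_reachable_of_le hn2 hconn ha hb hab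
  · exact (SimpleGraph.cycleGraph_induce_compl_reachable_of_le hn2 hconn hb ha hba).symm
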